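/- Let β > γ > 0, ρ₁, ρ₂ ∈ ℝ, T > 0, and let w : [0,T] → ℝ be continuous. Set D₃ = ((β−γ)/(1+β))·((1+β)/(1+γ))^{(1+γ)/(β−γ)}. Let h₁, h₂ : [0,T] → ℝ be differentiable with h₁(t), h₂(t) > 0 for all t, satisfying h₁′(t) = e^{ρ₁ w(t)}·(h₁(t)^{1+β} + h₂(t)^{1+γ}) and h₂′(t) = e^{ρ₂ w(t)}·(h₁(t)^{1+β} + h₂(t)^{1+γ}) on [0,T]. Let E(0) = h₁(0) + h₂(0) and ε₀ = min{1, (h₁(0)/D₃^{1/(1+γ)})^{β−γ}, (2^{−(1+γ)}·E(0)^{1+γ}/D₃)^{(β−γ)/(1+β)}}, and assume 2^{−(1+γ)}·ε₀·E(0)^{1+γ} > ε₀^{(1+β)/(β−γ)}·D₃. Then ∫₀ᵀ min(e^{ρ₁ w(s)}, e^{ρ₂ w(s)}) ds < [γ·E(0)^{γ}·(ε₀·2^{−(1+γ)} − ε₀^{(1+β)/(β−γ)}·D₃·E(0)^{−(1+γ)})]^{−1}. -/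

import Mathlib

open intervalIntegral Set Real

/-- Weighted Young inequality between the powers `x ^ a` and `x ^ b`, `a < b`. -/
theorem mul_rpow_sub_le_rpow {a b ε x : ℝ} (ha : 0 < a) (hab : a < b) (hε : 0 < ε) (hx : 0 < x) :
    ε * x ^ a - ε ^ (b / (b - a)) * ((b - a) / b * (b / a) ^ (a / (b - a))) ≤ x ^ b := by
  have hb : 0 < b := ha.trans hab
  have hd : 0 < b - a := sub_pos.2 hab
  have young := Real.geom_mean_le_arith_mean2_weighted (w₁ := a / b) (w₂ := (b - a) / b)
    (p₁ := x ^ b * (b / a)) (p₂ := ε ^ (b / (b - a)) * (a / b) ^ (a / (b - a)))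
    (by positivity) (by positivity) (by positivity) (by positivity) (by field_simp; ring)
  rw [Real.mul_rpow (by positivity) (by positivity), Real.mul_rpow (by positivity) (by positivity),
    ← Real.rpow_mul hx.le, ← Real.rpow_mul hε.le, ← Real.rpow_mul (by positivity),
    show b * (a / b) = a by field_simp, show b / (b - a) * ((b - a) / b) = 1 by field_simp,
    show a / (b - a) * ((b - a) / b) = a / b by field_simp, Real.rpow_one] at young
  have hcancel : (b / a) ^ (a / b) * (a / b) ^ (a / b) = 1 := by
    rw [← Real.mul_rpow (by positivity) (by positivity), show b / a * (a / b) = 1 by field_simp,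
      Real.one_rpow]
  have hprod : x ^ a * (b / a) ^ (a / b) * (ε * (a / b) ^ (a / b)) = ε * x ^ a := by
    linear_combination (ε * x ^ a) * hcancel
  have hmain : a / b * (x ^ b * (b / a)) = x ^ b := by field_simp
  rw [hprod, hmain] at young
  have hconst : (a / b) ^ (a / (b - a)) ≤ (b / a) ^ (a / (b - a)) := by
    refine Real.rpow_le_rpow (by positivity) ?_ (by positivity)
    exact ((div_le_one hb).2 hab.le).trans ((one_le_div ha).2 hab.le)
  have hmono := mul_le_mul_of_nonneg_left hconst
    (show 0 ≤ ε ^ (b / (b - a)) * ((b - a) / b) by positivity)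
  linarith

theorem two_rpow_neg_mul_add_rpow_le {a x y : ℝ} (ha : 0 ≤ a) (hx : 0 ≤ x) (hy : 0 ≤ y) :
    2 ^ (-a) * (x + y) ^ a ≤ x ^ a + y ^ a := by
  have hmax : (x + y) ^ a ≤ 2 ^ a * (x ^ a + y ^ a) := by
    have hx' := Real.rpow_nonneg hx a
    have hy' := Real.rpow_nonneg hy a
    rcases le_total x y with h | h
    · calc (x + y) ^ a ≤ (2 * y) ^ a := Real.rpow_le_rpow (by positivity) (by linarith) ha
        _ = 2 ^ a * y ^ a := Real.mul_rpow (by norm_num) hy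
        _ ≤ _ := by gcongr; linarith
    · calc (x + y) ^ a ≤ (2 * x) ^ a := Real.rpow_le_rpow (by positivity) (by linarith) ha
        _ = 2 ^ a * x ^ a := Real.mul_rpow (by norm_num) hx
        _ ≤ _ := by gcongr; linarith
  rw [Real.rpow_neg (by norm_num), inv_mul_le_iff₀ (by positivity)]
  exact hmax

/-- Blow-up bound for the differential inequality `c * m * E ^ (1 + γ) ≤ E'`. -/
theorem integral_lt_of_mul_rpow_le_deriv {γ T c : ℝ} (hγ : 0 < γ) (hc : 0 < c) (hT : 0 < T)
    {E E' m : ℝ → ℝ} (hm : ContinuousOn m (Icc 0 T)) (hpos : ∀ t ∈ Icc (0 : ℝ) T, 0 < E t)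
    (hderiv : ∀ t ∈ Icc (0 : ℝ) T, HasDerivWithinAt E (E' t) (Icc 0 T) t)
    (hle : ∀ t ∈ Icc (0 : ℝ) T, c * m t * E t ^ (1 + γ) ≤ E' t) :
    ∫ s in (0 : ℝ)..T, m s < (γ * E 0 ^ γ * c)⁻¹ := by
  have hder : ∀ t ∈ Icc (0 : ℝ) T, HasDerivWithinAt (fun s => -(E s ^ (-γ)))
      (-(E' t * (-γ) * E t ^ (-γ - 1))) (Icc 0 T) t := fun t ht =>
    ((hderiv t ht).rpow_const (Or.inl (hpos t ht).ne')).neg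
  have key := integral_le_sub_of_hasDeriv_right_of_le (g := fun s => -(E s ^ (-γ)))
    (φ := fun s => γ * c * m s) hT.le (fun t ht => (hder t ht).continuousWithinAt)
    (fun t ht => ((hder t (Ioo_subset_Icc_self ht)).hasDerivAt
      (Icc_mem_nhds ht.1 ht.2)).hasDerivWithinAt)
    ((continuousOn_const.mul hm).integrableOn_Icc)
    (fun t ht => by
      have ht' := Ioo_subset_Icc_self ht
      have hE := hpos t ht'
      have h1 := mul_le_mul_of_nonneg_right (hle t ht')
        (show 0 ≤ γ * E t ^ (-γ - 1) by positivity)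
      have h2 : E t ^ (1 + γ) * E t ^ (-γ - 1) = 1 := by
        rw [← Real.rpow_add hE, show 1 + γ + (-γ - 1) = 0 by ring, Real.rpow_zero]
      linear_combination h1 - γ * c * m t * h2)
  have h0 := hpos 0 (left_mem_Icc.2 hT.le)
  have hTpos : 0 < E T ^ (-γ) := Real.rpow_pos_of_pos (hpos T (right_mem_Icc.2 hT.le)) _
  rw [integral_const_mul, Real.rpow_neg h0.le] at key
  rw [show (γ * E 0 ^ γ * c)⁻¹ = (E 0 ^ γ)⁻¹ / (γ * c) by field_simp, lt_div_iff₀ (by positivity)]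
  linarith

/-- Pathwise content of Theorem 4.1, Case 2 (`m = p = β`, `n = q = γ`, `β > γ > 0`):
a positive solution of the comparison system on `[0,T]` forces the integral of
`min(e^{ρ₁ w}, e^{ρ₂ w})` to stay below the stated threshold. -/
theorem stmt_7 (β γ ρ₁ ρ₂ T : ℝ) (hγ : 0 < γ) (hβγ : γ < β) (hT : 0 < T)
    (w : ℝ → ℝ) (hw : ContinuousOn w (Icc 0 T))
    (D₃ : ℝ) (hD₃ : D₃ = ((β - γ) / (1 + β)) * ((1 + β) / (1 + γ)) ^ ((1 + γ) / (β - γ)))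
    (h₁ h₂ : ℝ → ℝ)
    (h₁_pos : ∀ t ∈ Icc (0 : ℝ) T, 0 < h₁ t) (h₂_pos : ∀ t ∈ Icc (0 : ℝ) T, 0 < h₂ t)
    (h₁_deriv : ∀ t ∈ Icc (0 : ℝ) T,
      HasDerivWithinAt h₁ (Real.exp (ρ₁ * w t) * (h₁ t ^ (1 + β) + h₂ t ^ (1 + γ))) (Icc 0 T) t)
    (h₂_deriv : ∀ t ∈ Icc (0 : ℝ) T,
      HasDerivWithinAt h₂ (Real.exp (ρ₂ * w t) * (h₁ t ^ (1 + β) + h₂ t ^ (1 + γ))) (Icc 0 T) t)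
    (E₀ : ℝ) (hE₀ : E₀ = h₁ 0 + h₂ 0)
    (ε₀ : ℝ)
    (hε₀ : ε₀ = min 1 (min ((h₁ 0 / D₃ ^ ((1 : ℝ) / (1 + γ))) ^ (β - γ))
      ((2 ^ (-(1 + γ)) * E₀ ^ (1 + γ) / D₃) ^ ((β - γ) / (1 + β)))))
    (hcond : ε₀ ^ ((1 + β) / (β - γ)) * D₃ < 2 ^ (-(1 + γ)) * ε₀ * E₀ ^ (1 + γ)) :
    ∫ s in (0 : ℝ)..T, min (Real.exp (ρ₁ * w s)) (Real.exp (ρ₂ * w s))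
      < (γ * E₀ ^ γ * (ε₀ * 2 ^ (-(1 + γ)) - ε₀ ^ ((1 + β) / (β - γ)) * D₃ * E₀ ^ (-(1 + γ))))⁻¹ := by
  have hD₃_pos : 0 < D₃ := by
    have hd : 0 < β - γ := sub_pos.2 hβγ
    have hβ : 0 < 1 + β := by linarith
    rw [hD₃]; positivity
  have h0mem : (0 : ℝ) ∈ Icc 0 T := left_mem_Icc.2 hT.le
  have h₁0 := h₁_pos 0 h0mem
  have h₂0 := h₂_pos 0 h0mem
  have hE₀_pos : 0 < E₀ := by rw [hE₀]; positivity
  have hε_pos : 0 < ε₀ := by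
    rw [hε₀]; refine lt_min one_pos (lt_min ?_ ?_) <;> positivity
  have hε_le : ε₀ ≤ 1 := hε₀ ▸ min_le_left _ _
  set δ := ε₀ ^ ((1 + β) / (β - γ)) * D₃ with hδ
  have hδ_pos : 0 < δ := by positivity
  have hcancel : ∀ {x : ℝ}, 0 < x → x ^ (-(1 + γ)) * x ^ (1 + γ) = 1 := fun hx => by
    rw [← Real.rpow_add hx, neg_add_cancel, Real.rpow_zero]
  have hc : 0 < ε₀ * 2 ^ (-(1 + γ)) - δ * E₀ ^ (-(1 + γ)) := by
    have := mul_lt_mul_of_pos_right hcond (Real.rpow_pos_of_pos hE₀_pos (-(1 + γ)))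
    linear_combination this + 2 ^ (-(1 + γ)) * ε₀ * hcancel hE₀_pos
  set c := ε₀ * 2 ^ (-(1 + γ)) - δ * E₀ ^ (-(1 + γ))
  have hderiv := fun t ht => (h₁_deriv t ht).add (h₂_deriv t ht)
  have hF : ∀ t ∈ Icc (0 : ℝ) T, 0 < h₁ t ^ (1 + β) + h₂ t ^ (1 + γ) := fun t ht =>
    add_pos (Real.rpow_pos_of_pos (h₁_pos t ht) _) (Real.rpow_pos_of_pos (h₂_pos t ht) _)
  have hmono : MonotoneOn (h₁ + h₂) (Icc 0 T) :=
    monotoneOn_of_hasDerivWithinAt_nonneg (convex_Icc 0 T)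
      (fun t ht => (hderiv t ht).continuousWithinAt)
      (fun t ht => (hderiv t (interior_subset ht)).mono interior_subset)
      (fun t ht => by have := hF t (interior_subset ht); positivity)
  have hF_lower : ∀ t ∈ Icc (0 : ℝ) T,
      c * (h₁ t + h₂ t) ^ (1 + γ) ≤ h₁ t ^ (1 + β) + h₂ t ^ (1 + γ) := fun t ht => by
    have hx := h₁_pos t ht
    have hy := h₂_pos t ht
    have young := mul_rpow_sub_le_rpow (a := 1 + γ) (b := 1 + β) (by linarith) (by linarith)
      hε_pos hx
    rw [show 1 + β - (1 + γ) = β - γ by ring, ← hD₃, ← hδ] at young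
    have hmean := mul_le_mul_of_nonneg_left
      (two_rpow_neg_mul_add_rpow_le (a := 1 + γ) (by linarith) hx.le hy.le) hε_pos.le
    have hy' := mul_le_mul_of_nonneg_right hε_le (Real.rpow_nonneg hy.le (1 + γ))
    have hE : E₀ ^ (1 + γ) ≤ (h₁ t + h₂ t) ^ (1 + γ) :=
      Real.rpow_le_rpow hE₀_pos.le (hE₀ ▸ hmono h0mem ht ht.1) (by linarith)
    have hE' := mul_le_mul_of_nonneg_left hE
      (show 0 ≤ δ * E₀ ^ (-(1 + γ)) by positivity)
    linear_combination young + hmean + hy' + hE' - δ * hcancel hE₀_pos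
  have hm : ContinuousOn (fun s => min (Real.exp (ρ₁ * w s)) (Real.exp (ρ₂ * w s))) (Icc 0 T) := by
    fun_prop
  rw [hE₀]
  refine integral_lt_of_mul_rpow_le_deriv hγ hc hT (E := h₁ + h₂) hm
    (fun t ht => add_pos (h₁_pos t ht) (h₂_pos t ht)) hderiv fun t ht => ?_
  have hFt := hF t ht
  calc c * min (Real.exp (ρ₁ * w t)) (Real.exp (ρ₂ * w t)) * (h₁ t + h₂ t) ^ (1 + γ)
      = min (Real.exp (ρ₁ * w t)) (Real.exp (ρ₂ * w t)) * (c * (h₁ t + h₂ t) ^ (1 + γ)) := by ring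
    _ ≤ Real.exp (ρ₁ * w t) * (h₁ t ^ (1 + β) + h₂ t ^ (1 + γ)) :=
      mul_le_mul (min_le_left _ _) (hF_lower t ht)
        (mul_nonneg hc.le (Real.rpow_nonneg (add_pos (h₁_pos t ht) (h₂_pos t ht)).le _))
        (Real.exp_pos _).le
    _ ≤ _ := le_add_of_nonneg_right (by positivity)
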